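/- arXiv:1210.2644 — 3 statements merged into one kernel-verified Lean document; each statement's English description precedes it below -/
import Mathlib

section
/- Let a₁, …, a_N ∈ ℝ^N be nonzero vectors, 0 ≤ ω ≤ 2, Q_i = I − ω·(a_i a_iᵀ)/‖a_i‖₂², and let Q = Q₁ Q₂ ⋯ Q_{N−1} Q_N Q_N Q_{N−1} ⋯ Q₂ Q₁ be the symmetric Kaczmarz double-sweep matrix. Then I − Q is symmetric positive semi-definite, i.e. for every x ∈ ℝ^N, ⟪x, (I − Q)x⟫ ≥ 0. -/
open Matrix

theorem kacz_step {N : ℕ} (a : Fin N → ℝ) (ha : a ≠ 0) (ω : ℝ) (h0 : 0 ≤ ω) (h2 : ω ≤ 2)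
    (x : Fin N → ℝ) :
    ((1 - (ω / (a ⬝ᵥ a)) • vecMulVec a a) *ᵥ x) ⬝ᵥ ((1 - (ω / (a ⬝ᵥ a)) • vecMulVec a a) *ᵥ x)
      ≤ x ⬝ᵥ x := by
  have hs : a ⬝ᵥ a ≠ 0 := fun h => ha (dotProduct_self_eq_zero.mp h)
  have hs0 : 0 ≤ a ⬝ᵥ a := Finset.sum_nonneg fun i _ => mul_self_nonneg (a i)
  have hv : (1 - (ω / (a ⬝ᵥ a)) • vecMulVec a a) *ᵥ x
      = x - (ω / (a ⬝ᵥ a) * (a ⬝ᵥ x)) • a := by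
    rw [sub_mulVec, one_mulVec, smul_mulVec, vecMulVec_mulVec]
    ext i
    simp
    ring
  rw [hv]
  simp only [sub_dotProduct, dotProduct_sub, smul_dotProduct, dotProduct_smul, smul_eq_mul]
  rw [dotProduct_comm x a]
  generalize a ⬝ᵥ x = d at *
  generalize a ⬝ᵥ a = s at *
  have key : 0 ≤ ω * (2 - ω) * d ^ 2 / s :=
    div_nonneg (mul_nonneg (mul_nonneg h0 (by linarith)) (sq_nonneg d)) hs0
  have e : x ⬝ᵥ x - ω / s * d * d - ω / s * d * (d - ω / s * d * s)
      = x ⬝ᵥ x - ω * (2 - ω) * d ^ 2 / s := by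
    field_simp
    ring
  linarith

theorem kacz_list {N : ℕ} (Qs : Fin N → Matrix (Fin N) (Fin N) ℝ)
    (h : ∀ i x, (Qs i *ᵥ x) ⬝ᵥ (Qs i *ᵥ x) ≤ x ⬝ᵥ x) (l : List (Fin N)) :
    ∀ x, ((l.map Qs).reverse.prod *ᵥ x) ⬝ᵥ ((l.map Qs).reverse.prod *ᵥ x) ≤ x ⬝ᵥ x := by
  induction l with
  | nil => intro x; simp
  | cons i l ih =>
    intro x
    have e : ((i :: l).map Qs).reverse.prod = (l.map Qs).reverse.prod * Qs i := by simp
    rw [e, ← mulVec_mulVec]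
    exact (ih _).trans (h i x)

theorem kacz_transpose {N : ℕ} (Qs : Fin N → Matrix (Fin N) (Fin N) ℝ)
    (h : ∀ i, (Qs i)ᵀ = Qs i) (l : List (Fin N)) :
    ((l.map Qs).reverse.prod)ᵀ = (l.map Qs).prod := by
  induction l with
  | nil => simp
  | cons i l ih =>
    have e : ((i :: l).map Qs).reverse.prod = (l.map Qs).reverse.prod * Qs i := by simp
    rw [e, transpose_mul, ih, h]
    simp

/-- For nonzero vectors `a₁, …, a_N ∈ ℝ^N`, `0 ≤ ω ≤ 2`, Kaczmarz projections
`Q_i = I - ω (a_i a_iᵀ)/‖a_i‖₂²`, and the symmetric Kaczmarz double-sweep matrix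
`Q = Q₁ ⋯ Q_N Q_N ⋯ Q₁`, the matrix `I - Q` is symmetric positive semi-definite:
`(I - Q)ᵀ = I - Q` and `⟪x, (I - Q) x⟫ ≥ 0` for every `x`. -/
theorem double_sweep_id_sub_psd {N : ℕ}
    (a : Fin N → (Fin N → ℝ)) (ha : ∀ i, a i ≠ 0)
    (ω : ℝ) (hω₀ : 0 ≤ ω) (hω₂ : ω ≤ 2)
    (Qs : Fin N → Matrix (Fin N) (Fin N) ℝ)
    (hQs : ∀ i, Qs i = 1 - (ω / (a i ⬝ᵥ a i)) • vecMulVec (a i) (a i))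
    (Q : Matrix (Fin N) (Fin N) ℝ)
    (hQ : Q = ((List.finRange N).map Qs).prod *
              (((List.finRange N).map Qs).reverse).prod) :
    (1 - Q)ᵀ = 1 - Q ∧ ∀ x : Fin N → ℝ, 0 ≤ x ⬝ᵥ ((1 - Q) *ᵥ x) := by
  have hT := kacz_transpose Qs (fun i => by
    rw [hQs i, transpose_sub, transpose_one, transpose_smul, transpose_vecMulVec])
    (List.finRange N)
  have hL := kacz_list Qs (fun i x => by
    rw [hQs i]; exact kacz_step (a i) (ha i) ω hω₀ hω₂ x) (List.finRange N)
  rw [← hT] at hQ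
  generalize ((List.finRange N).map Qs).reverse.prod = R at hQ hL
  subst hQ
  refine ⟨by simp, fun x => ?_⟩
  have h := hL x
  rw [sub_mulVec, one_mulVec, dotProduct_sub, ← mulVec_mulVec, dotProduct_mulVec x Rᵀ,
    vecMul_transpose]
  linarith
end

section
/- Let D be an N×N real diagonal matrix and L an N×N real strictly lower triangular matrix, let ω ∈ ℝ be such that D + ωL is invertible, and define H = ω(2−ω)(D+ωLᵀ)⁻¹ D (D+ωL)⁻¹. Then H is symmetric; moreover, if 0 < ω < 2 and all diagonal entries of D are positive, then H is positive definite. -/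
open Matrix

/-- The SSOR preconditioning matrix `H = ω(2−ω)(D+ωLᵀ)⁻¹ D (D+ωL)⁻¹` (with `D`
diagonal, `L` strictly lower triangular and `D + ωL` invertible) is symmetric;
moreover, if `0 < ω < 2` and all diagonal entries of `D` are positive, then `H`
is positive definite. -/
theorem ssor_H_symm_posDef {N : ℕ}
    (D L : Matrix (Fin N) (Fin N) ℝ)
    (hD : D.IsDiag) (hL : ∀ i j : Fin N, i ≤ j → L i j = 0)
    (ω : ℝ) (hinv : IsUnit (D + ω • L))
    (H : Matrix (Fin N) (Fin N) ℝ)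
    (hH : H = (ω * (2 - ω)) • ((D + ω • Lᵀ)⁻¹ * D * (D + ω • L)⁻¹)) :
    Hᵀ = H ∧ (0 < ω → ω < 2 → (∀ i, 0 < D i i) → H.PosDef) := by
  have hDt : Dᵀ = D := hD.isSymm
  have hT : (D + ω • Lᵀ)⁻¹ = ((D + ω • L)⁻¹)ᵀ := by
    rw [transpose_nonsing_inv, transpose_add, transpose_smul, hDt]
  rw [hT] at hH
  subst hH
  refine ⟨?_, ?_⟩
  · rw [transpose_smul, transpose_mul, transpose_mul, transpose_transpose, hDt, Matrix.mul_assoc]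
  · intro h0 h2 hpos
    have hDp : D.PosDef := by
      rw [← hD.diagonal_diag]
      exact PosDef.diagonal hpos
    have hU : IsUnit (D + ω • L)⁻¹ := (isUnit_nonsing_inv_iff).2 hinv
    have h := hDp.conjTranspose_mul_mul_same (mulVec_injective_of_isUnit hU)
    rw [conjTranspose_eq_transpose_of_trivial] at h
    exact h.smul (mul_pos h0 (by linarith))
end

section
/- Let A be an N×N real matrix all of whose rows a₁, …, a_N are nonzero, and let 0 < ω < 2. Write A Aᵀ = D + L + Lᵀ where D is the diagonal of A Aᵀ (so d_{ii} = ‖a_i‖₂²) and L is the strictly lower triangular part of A Aᵀ, and define H = ω(2−ω)(D+ωLᵀ)⁻¹ D (D+ωL)⁻¹. Let Q_i = I − ω·(a_i a_iᵀ)/‖a_i‖₂² and let Q = Q₁ Q₂ ⋯ Q_{N−1} Q_N Q_N Q_{N−1} ⋯ Q₂ Q₁ be the symmetric Kaczmarz double-sweep matrix. Then Q = I − Aᵀ H A. -/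
open Matrix

lemma sweep_aux {N : ℕ} (A Y : Matrix (Fin N) (Fin N) ℝ) (hA : ∀ i, A i ≠ 0) (ω : ℝ)
    (hY : ∀ i, (A i ⬝ᵥ A i) • Y i
      + ω • ∑ j ∈ Finset.univ.filter (fun j => j < i), (A i ⬝ᵥ A j) • Y j = A i)
    (Qs : Fin N → Matrix (Fin N) (Fin N) ℝ)
    (hQs : ∀ i, Qs i = 1 - (ω / (A i ⬝ᵥ A i)) • vecMulVec (A i) (A i)) (k : ℕ) (hk : k ≤ N) :
    ((((List.finRange N).map Qs).take k).reverse).prod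
      = 1 - ω • ∑ j ∈ Finset.univ.filter (fun j : Fin N => (j : ℕ) < k),
          vecMulVec (A j) (Y j) := by
  induction k with
  | zero => simp
  | succ k ih =>
    have hkN : k < N := hk
    set i : Fin N := ⟨k, hkN⟩ with hi
    have hd : A i ⬝ᵥ A i ≠ 0 := by
      intro h
      exact hA i (dotProduct_self_eq_zero.mp h)
    have h1 : ((List.finRange N).map Qs).take (k+1)
        = ((List.finRange N).map Qs).take k ++ [Qs i] := by
      rw [List.take_succ_eq_append_getElem (by simpa using hkN)]
      simp [hi]
    have h2 : Finset.univ.filter (fun j : Fin N => (j : ℕ) < k + 1)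
        = insert i (Finset.univ.filter (fun j : Fin N => (j : ℕ) < k)) := by
      ext j
      simp [hi, Fin.ext_iff]
      omega
    have h3 : Finset.univ.filter (fun j : Fin N => j < i)
        = Finset.univ.filter (fun j : Fin N => (j : ℕ) < k) := by
      ext j
      simp [hi, Fin.lt_def]
    have hYi := hY i
    rw [h3] at hYi
    have h4 : vecMulVec (A i) (A i) * (1 - ω • ∑ j ∈ Finset.univ.filter
        (fun j : Fin N => (j : ℕ) < k), vecMulVec (A j) (Y j))
        = (A i ⬝ᵥ A i) • vecMulVec (A i) (Y i) := by
      ext p q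
      have := congrFun hYi q
      simp only [Pi.add_apply, Pi.smul_apply, Finset.sum_apply, smul_eq_mul] at this
      simp only [mul_sub, mul_one, Matrix.mul_smul, Matrix.mul_sum, vecMulVec_mul_vecMulVec,
        Matrix.sub_apply, Matrix.smul_apply, Matrix.sum_apply, vecMulVec_apply, smul_eq_mul,
        Pi.smul_apply]
      have h5 : ∀ s : Finset (Fin N), ∑ j ∈ s, A i p * ((A i ⬝ᵥ A j) * Y j q)
          = A i p * ∑ j ∈ s, (A i ⬝ᵥ A j) * Y j q := fun s => (Finset.mul_sum _ _ _).symm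
      rw [h5]
      linear_combination (-A i p) * this
    rw [h1, List.reverse_append, List.reverse_singleton, List.singleton_append, List.prod_cons,
      ih (by omega), hQs, sub_mul, one_mul, Matrix.smul_mul, h4, smul_smul,
      div_mul_cancel₀ _ hd, h2, Finset.sum_insert (by simp [hi]), smul_add]
    abel

/-- Equivalence of the symmetric Kaczmarz double sweep with SSOR on the normal
equations: for `A` with nonzero rows `a_i`, `0 < ω < 2`, `A Aᵀ = D + L + Lᵀ`
(`D` its diagonal part, `L` its strictly lower triangular part),
`H = ω(2−ω)(D+ωLᵀ)⁻¹ D (D+ωL)⁻¹`, `Q_i = I − ω (a_i a_iᵀ)/‖a_i‖₂²`, and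
`Q = Q₁ ⋯ Q_N Q_N ⋯ Q₁`, we have `Q = I − Aᵀ H A`. -/
theorem double_sweep_eq_one_sub_AtHA {N : ℕ}
    (A : Matrix (Fin N) (Fin N) ℝ) (hA : ∀ i, A i ≠ 0)
    (ω : ℝ) (hω₀ : 0 < ω) (hω₂ : ω < 2)
    (D L : Matrix (Fin N) (Fin N) ℝ)
    (hD : D = Matrix.diagonal fun i => (A * Aᵀ) i i)
    (hL : L = Matrix.of fun i j => if j < i then (A * Aᵀ) i j else 0)
    (H : Matrix (Fin N) (Fin N) ℝ)
    (hH : H = (ω * (2 - ω)) • ((D + ω • Lᵀ)⁻¹ * D * (D + ω • L)⁻¹))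
    (Qs : Fin N → Matrix (Fin N) (Fin N) ℝ)
    (hQs : ∀ i, Qs i = 1 - (ω / (A i ⬝ᵥ A i)) • vecMulVec (A i) (A i))
    (Q : Matrix (Fin N) (Fin N) ℝ)
    (hQ : Q = ((List.finRange N).map Qs).prod *
              (((List.finRange N).map Qs).reverse).prod) :
    Q = 1 - Aᵀ * H * A := by
  have hd : ∀ i, A i ⬝ᵥ A i ≠ 0 := fun i h => hA i (dotProduct_self_eq_zero.mp h)
  have hG : ∀ i j, (A * Aᵀ) i j = A i ⬝ᵥ A j := fun i j => rfl
  set M := D + ω • L with hM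
  have hMT : D + ω • Lᵀ = Mᵀ := by
    rw [hM, transpose_add, transpose_smul, hD, diagonal_transpose]
  have hdet : IsUnit M.det := by
    have ht : M.BlockTriangular OrderDual.toDual := by
      intro i j hij
      have hij' : i < j := hij
      simp [hM, hD, hL, hij'.ne, not_lt.mpr hij'.le]
    rw [det_of_lowerTriangular M ht]
    refine isUnit_iff_ne_zero.mpr (Finset.prod_ne_zero_iff.mpr fun i _ => ?_)
    simpa [hM, hD, hL, hG] using hd i
  have hdetT : IsUnit Mᵀ.det := by rwa [det_transpose]
  have hMY : M * (M⁻¹ * A) = A := mul_nonsing_inv_cancel_left _ _ hdet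
  have hR : (((List.finRange N).map Qs).reverse).prod = 1 - ω • (Aᵀ * (M⁻¹ * A)) := by
    have key := sweep_aux A (M⁻¹ * A) hA ω ?_ Qs hQs N le_rfl
    · rw [List.take_of_length_le (by simp)] at key
      rw [key]
      congr 2
      ext p q
      rw [Matrix.mul_apply]
      simp [Matrix.sum_apply, vecMulVec_apply]
    · intro i
      ext q
      generalize M⁻¹ * A = Y at hMY
      conv_rhs => rw [← hMY]
      simp only [hM, hD, hL, add_mul, Matrix.smul_mul, Matrix.add_apply, Matrix.smul_apply,
        diagonal_mul, hG, Pi.add_apply, Pi.smul_apply, Finset.sum_apply, smul_eq_mul]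
      rw [Matrix.mul_apply, Finset.sum_filter]
      simp [ite_mul, hG]
  have hP : ((List.finRange N).map Qs).prod = 1 - ω • (Aᵀ * (Mᵀ⁻¹ * A)) := by
    have h1 : ((((List.finRange N).map Qs).reverse).prod)ᵀ = ((List.finRange N).map Qs).prod := by
      rw [Matrix.transpose_list_prod, List.map_reverse, List.reverse_reverse, List.map_map]
      congr 2
      funext i
      simp [hQs, transpose_vecMulVec]
    rw [← h1, hR]
    simp [transpose_sub, transpose_mul, transpose_nonsing_inv, Matrix.mul_assoc]
  have hsum : (2 - ω) • D = M + Mᵀ - ω • (A * Aᵀ) := by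
    ext i j
    have hs : (A * Aᵀ) j i = (A * Aᵀ) i j := by rw [hG, hG, dotProduct_comm]
    rcases lt_trichotomy i j with h | h | h
    · simp [hM, hD, hL, h, h.ne, h.ne', not_lt.mpr h.le, hs]
    · subst h
      simp [hM, hD, hL]
      ring
    · simp [hM, hD, hL, h, h.ne, h.ne', not_lt.mpr h.le, hs]
  have hH' : H = ω • (M⁻¹ + Mᵀ⁻¹ - ω • (Mᵀ⁻¹ * (A * Aᵀ) * M⁻¹)) := by
    have e : Mᵀ⁻¹ * ((2 - ω) • D) * M⁻¹ = Mᵀ⁻¹ + M⁻¹ - ω • (Mᵀ⁻¹ * (A * Aᵀ) * M⁻¹) := by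
      rw [hsum, mul_sub, mul_add, sub_mul, add_mul, nonsing_inv_mul _ hdetT, one_mul,
        Matrix.mul_assoc, mul_nonsing_inv _ hdet, mul_one, Matrix.mul_smul, Matrix.smul_mul]
    rw [hH, hMT, add_comm M⁻¹, ← e, Matrix.mul_smul, Matrix.smul_mul, smul_smul]
  rw [hQ, hP, hR, hH']
  simp only [mul_sub, sub_mul, mul_add, add_mul, mul_one, one_mul, Matrix.mul_smul,
    Matrix.smul_mul, Matrix.mul_assoc, smul_sub, smul_add]
  abel
end
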